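/- arXiv:2106.07300 — 5 statements merged into one kernel-verified Lean document; each statement's English description precedes it below -/
import Mathlib

section
/- Let I be an instance of fair allocation under cardinality constraints admitting at least one feasible allocation, and let I' be the ordered instance obtained from I by, for each agent i and each category C_h, reassigning agent i's values on C_h so that the multiset of values is preserved and the items of each category are ranked in a common nonincreasing order for all agents. If I' admits a feasible α-approximate MMS allocation, then I admits a feasible α-approximate MMS allocation. -/
open Finset

/-- A partition of all items into `n` (possibly empty) bundles: every item
belongs to exactly one bundle. -/
def IsPartition {M : Type*} {n : ℕ} (A : Fin n → Finset M) : Prop :=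
  ∀ j : M, ∃! i, j ∈ A i

/-- A bundle is feasible if it contains at most `k h` items from each category `h`. -/
def FeasibleBundle {M : Type*} {ℓ : ℕ} (cat : M → Fin ℓ) (k : Fin ℓ → ℕ)
    (B : Finset M) : Prop :=
  ∀ h, (B.filter (fun j => cat j = h)).card ≤ k h

/-- A feasible allocation: a partition of the items into `n` feasible bundles. -/
def FeasibleAlloc {M : Type*} {n ℓ : ℕ} (cat : M → Fin ℓ) (k : Fin ℓ → ℕ)
    (A : Fin n → Finset M) : Prop :=
  IsPartition A ∧ ∀ i, FeasibleBundle cat k (A i)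

/-- The maximin share of an agent with additive valuation given by item values `v`,
in the instance with `n` agents, categories `cat` and thresholds `k`. -/
noncomputable def mms (n : ℕ) {M : Type*} {ℓ : ℕ} (cat : M → Fin ℓ)
    (k : Fin ℓ → ℕ) (v : M → ℝ) : ℝ :=
  sSup {x | ∃ A : Fin n → Finset M, FeasibleAlloc cat k A ∧ x = ⨅ i, ∑ j ∈ A i, v j}

theorem FeasibleAlloc.map_perm {M : Type*} {n ℓ : ℕ} {cat : M → Fin ℓ} {k : Fin ℓ → ℕ}
    {A : Fin n → Finset M} (hA : FeasibleAlloc cat k A) (π : Equiv.Perm M)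
    (hπ : ∀ x, cat (π x) = cat x) :
    FeasibleAlloc cat k (fun i => (A i).map π.toEmbedding) := by
  refine ⟨fun j => ?_, fun i h => ?_⟩
  · simpa [Finset.mem_map_equiv] using hA.1 (π.symm j)
  · simpa [Finset.filter_map, Function.comp_def, hπ] using hA.2 i h

/-- If the values `w` are obtained from `u` by rearranging within each category, and all agents
rank each category under `w` in a common order, then for any assignment `a` of items to agents,
the items can be permuted within their categories so that, for each `x`, the agent `a x` values
the item `π x` under `u` at least as much as the item `x` under `w`. -/
theorem exists_perm_le_of_ordered {M β : Type*} [Fintype M] [DecidableEq M] {ℓ : ℕ}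
    (cat : M → Fin ℓ) (u w : β → M → ℝ)
    (hmulti : ∀ i h,
      (univ.filter (fun x => cat x = h)).val.map (u i) =
        (univ.filter (fun x => cat x = h)).val.map (w i))
    (hord : ∀ j j', cat j = cat j' → (∀ i, w i j ≤ w i j') ∨ (∀ i, w i j' ≤ w i j))
    (a : M → β) :
    ∃ π : Equiv.Perm M, (∀ x, cat (π x) = cat x) ∧ ∀ x, w (a x) x ≤ u (a x) (π x) := by
  classical
  let t : M → Finset M := fun x => univ.filter fun y => cat y = cat x ∧ w (a x) x ≤ u (a x) y
  have card_t (x : M) :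
      (univ.filter fun y => cat y = cat x ∧ w (a x) x ≤ w (a x) y).card = (t x).card := by
    have := congrArg (Multiset.countP (w (a x) x ≤ ·)) (hmulti (a x) (cat x))
    simp only [Multiset.countP_map, ← Finset.filter_val, Finset.card_val,
      Finset.filter_filter] at this
    exact this.symm
  have hall (T : Finset M) : T.card ≤ (T.biUnion t).card := by
    rw [card_eq_sum_card_fiberwise (f := cat) (t := univ) (by simp),
      card_eq_sum_card_fiberwise (s := T.biUnion t) (f := cat) (t := univ) (by simp)]
    refine sum_le_sum fun h _ => ?_
    rcases (T.filter (cat · = h)).eq_empty_or_nonempty with hT | hT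
    · simp [hT]
    obtain ⟨s, hs, hmin⟩ := exists_minimalFor (fun x i => w i x) _ hT
    obtain ⟨hsT, rfl⟩ := mem_filter.1 hs
    calc (T.filter (cat · = cat s)).card
        ≤ (univ.filter fun y => cat y = cat s ∧ w (a s) s ≤ w (a s) y).card := by
          refine card_le_card fun y hy => ?_
          have hcat := (mem_filter.1 hy).2
          refine mem_filter.2 ⟨mem_univ y, hcat, ?_⟩
          rcases hord y s hcat with hle | hle
          · exact hmin hy hle (a s)
          · exact hle (a s)
      _ = (t s).card := card_t s
      _ ≤ _ := card_le_card fun y hy =>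
          mem_filter.2 ⟨mem_biUnion.2 ⟨s, hsT, hy⟩, (mem_filter.1 hy).2.1⟩
  obtain ⟨f, hf, hft⟩ := (all_card_le_biUnion_card_iff_exists_injective t).1 hall
  have hft' (x : M) := (mem_filter.1 (hft x)).2
  exact ⟨Equiv.ofBijective f (Finite.injective_iff_bijective.1 hf),
    fun x => (hft' x).1, fun x => (hft' x).2⟩

theorem mms_le_mms_of_map_eq {M : Type*} [Fintype M] [DecidableEq M] {n ℓ : ℕ}
    {cat : M → Fin ℓ} {k : Fin ℓ → ℕ} {u w : M → ℝ}
    (hmulti : ∀ h,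
      (univ.filter (fun x => cat x = h)).val.map u =
        (univ.filter (fun x => cat x = h)).val.map w)
    (hfeas : ∃ A : Fin n → Finset M, FeasibleAlloc cat k A) :
    mms n cat k w ≤ mms n cat k u := by
  obtain ⟨π, hcat, hle⟩ := exists_perm_le_of_ordered (β := Unit) cat (fun _ => u) (fun _ => w)
    (fun _ h => hmulti h) (fun j j' _ => by simpa using le_total (w j) (w j')) (fun _ => ())
  obtain ⟨A₀, hA₀⟩ := hfeas
  refine csSup_le ⟨_, A₀, hA₀, rfl⟩ ?_
  rintro _ ⟨A, hA, rfl⟩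
  have hbdd : BddAbove {x | ∃ A : Fin n → Finset M,
      FeasibleAlloc cat k A ∧ x = ⨅ i, ∑ j ∈ A i, u j} :=
    ((Set.finite_range fun A : Fin n → Finset M => ⨅ i, ∑ j ∈ A i, u j).subset
      (by rintro _ ⟨A, -, rfl⟩; exact ⟨A, rfl⟩)).bddAbove
  refine le_trans ?_ (le_csSup hbdd ⟨_, hA.map_perm π hcat, rfl⟩)
  refine ciInf_mono (Set.finite_range _).bddBelow fun i => ?_
  rw [sum_map]
  exact sum_le_sum fun x _ => hle x

/-- If the ordered instance obtained from `I` (same per-agent,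
per-category multisets of values; all agents share a common nonincreasing ranking
of the items of each category) admits a feasible α-approximate MMS allocation,
then so does `I`. -/
theorem stmt_6 {m ℓ n : ℕ} (hn : 1 ≤ n)
    (cat : Fin m → Fin ℓ) (k : Fin ℓ → ℕ)
    (v v' : Fin n → Fin m → ℝ)
    (hv : ∀ i j, 0 ≤ v i j) (hv' : ∀ i j, 0 ≤ v' i j)
    (hmulti : ∀ i h,
      (univ.filter (fun x => cat x = h)).val.map (v i) =
        (univ.filter (fun x => cat x = h)).val.map (v' i))
    (hord : ∀ j j', cat j = cat j' →
      (∀ i, v' i j ≤ v' i j') ∨ (∀ i, v' i j' ≤ v' i j))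
    (hfeas : ∃ A : Fin n → Finset (Fin m), FeasibleAlloc cat k A)
    (α : ℝ)
    (hex : ∃ A' : Fin n → Finset (Fin m), FeasibleAlloc cat k A' ∧
      ∀ i, α * mms n cat k (v' i) ≤ ∑ x ∈ A' i, v' i x) :
    ∃ A : Fin n → Finset (Fin m), FeasibleAlloc cat k A ∧
      ∀ i, α * mms n cat k (v i) ≤ ∑ x ∈ A i, v i x := by
  obtain ⟨A', hA', hval⟩ := hex
  choose a ha using fun j => (hA'.1 j).exists
  obtain ⟨π, hcat, hle⟩ := exists_perm_le_of_ordered cat v v' hmulti hord a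
  refine ⟨_, hA'.map_perm π hcat, fun i => ?_⟩
  have hmms : mms n cat k (v i) = mms n cat k (v' i) :=
    le_antisymm (mms_le_mms_of_map_eq (fun h => (hmulti i h).symm) hfeas)
      (mms_le_mms_of_map_eq (hmulti i) hfeas)
  rw [hmms, sum_map]
  refine (hval i).trans (sum_le_sum fun x hx => ?_)
  obtain rfl := (hA'.1 x).unique (ha x) hx
  exact hle x
end

section
/- Let I be an ordered instance of fair allocation under cardinality constraints with n ≥ 2 agents, |C_h| ≤ n·k_h for all h, and v_i(M) = n for all agents i. Suppose some agent i and item j satisfy v_i({j}) ≥ α for some α > 0. Let B be the bundle consisting of j together with, for each category C_h, the max(0, |C_h \ {j}| − (n−1)·k_h) items of C_h \ {j} of least value. Then: (1) B is feasible and v_i(B) ≥ α ≥ α·μ_i; (2) the reduced instance I' obtained by removing agent i and the items of B admits a feasible allocation; and (3) for every remaining agent i' ≠ i, the maximin share of i' in I' is at least the maximin share of i' in I. -/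
open Finset

/-- Category-wise cardinality bounds give an injection that preserves categories. -/
lemma exists_injOn_preserving_of_card_le {α β : Type*} [DecidableEq β] (c : α → β)
    (S T : Finset α)
    (h : ∀ b, (S.filter (fun x => c x = b)).card ≤ (T.filter (fun x => c x = b)).card) :
    ∃ φ : α → α, Set.InjOn φ S ∧ ∀ x ∈ S, φ x ∈ T ∧ c (φ x) = c x := by
  classical
  have emb (b : β) : Nonempty ((S.filter (fun x => c x = b)) ↪ (T.filter (fun x => c x = b))) :=
    Function.Embedding.nonempty_of_card_le (by simpa only [Fintype.card_coe] using h b)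
  have f := fun b => (emb b).some
  have hmem {x : α} (hx : x ∈ S) : x ∈ S.filter (fun y => c y = c x) := by simp [hx]
  have hf {x : α} (hx : x ∈ S) :
      (f (c x) ⟨x, hmem hx⟩ : α) ∈ T ∧ c (f (c x) ⟨x, hmem hx⟩ : α) = c x := by
    exact mem_filter.1 (f (c x) ⟨x, hmem hx⟩).2
  refine ⟨fun x => if hx : x ∈ S then f (c x) ⟨x, hmem hx⟩ else x, ?_, ?_⟩
  · intro x hx y hy hxy
    have hx' : x ∈ S := hx
    have hy' : y ∈ S := hy
    simp only [hx', hy', dif_pos] at hxy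
    have hc : c x = c y := by rw [← (hf hx').2, ← (hf hy').2, hxy]
    have key : ∀ b (hb : c y = b) (h' : x ∈ S.filter (fun z => c z = b)),
        (f b ⟨x, h'⟩ : α) = f (c y) ⟨y, hmem hy'⟩ → x = y := by
      rintro b rfl h' he
      simpa using (f (c y)).injective (Subtype.ext he)
    exact key (c x) hc.symm (hmem hx') hxy
  · intro x hx
    simpa [hx] using hf hx

/-- Disjoint feasible bundles extend to a feasible allocation whenever there is enough room
for all the items of every category. -/
lemma exists_feasibleAlloc_extending {M : Type*} [Fintype M] {n ℓ : ℕ}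
    (cat : M → Fin ℓ) (k : Fin ℓ → ℕ)
    (hcard : ∀ h, (univ.filter (fun x => cat x = h)).card ≤ n * k h)
    (A : Fin n → Finset M) (hdisj : ∀ i i' x, x ∈ A i → x ∈ A i' → i = i')
    (hfeas : ∀ i, FeasibleBundle cat k (A i)) :
    ∃ A' : Fin n → Finset M, FeasibleAlloc cat k A' ∧ ∀ i, A i ⊆ A' i := by
  classical
  suffices H : ∀ s : Finset M, ∃ A' : Fin n → Finset M,
      (∀ i i' x, x ∈ A' i → x ∈ A' i' → i = i') ∧ (∀ i, FeasibleBundle cat k (A' i)) ∧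
      (∀ i, A i ⊆ A' i) ∧ ∀ x ∈ s, ∃ i, x ∈ A' i by
    obtain ⟨A', hd, hf, hs, hc⟩ := H univ
    refine ⟨A', ⟨fun x => ?_, hf⟩, hs⟩
    obtain ⟨i, hi⟩ := hc x (mem_univ x)
    exact ⟨i, hi, fun i' hi' => hd _ _ _ hi' hi⟩
  intro s
  induction s using Finset.induction_on with
  | empty => exact ⟨A, hdisj, hfeas, fun _ => Subset.rfl, by simp⟩
  | insert x s _ ih =>
    obtain ⟨A', hd, hf, hs, hc⟩ := ih
    by_cases hx : ∃ i, x ∈ A' i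
    · exact ⟨A', hd, hf, hs, by simpa [hx] using hc⟩
    push Not at hx
    have room : ∃ i, ((A' i).filter (fun y => cat y = cat x)).card < k (cat x) := by
      by_contra! hfull
      have hle : n * k (cat x) ≤ ∑ i, ((A' i).filter (fun y => cat y = cat x)).card := by
        simpa using Finset.card_nsmul_le_sum univ _ _ fun i _ => hfull i
      rw [← Finset.card_biUnion] at hle
      · have hlt : (univ.biUnion fun i => (A' i).filter (fun y => cat y = cat x)).card <
            (univ.filter (fun y => cat y = cat x)).card := by
          apply Finset.card_lt_card
          refine (Finset.ssubset_iff_of_subset ?_).2 ⟨x, by simp, by simpa using hx⟩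
          intro y
          simp
        exact absurd (hcard (cat x)) (by omega)
      · intro i _ i' _ hii'
        refine Finset.disjoint_left.2 fun y hy hy' => hii' ?_
        exact hd i i' y (Finset.mem_filter.1 hy).1 (Finset.mem_filter.1 hy').1
    obtain ⟨i, hi⟩ := room
    have hmem {i' : Fin n} {y : M} :
        y ∈ Function.update A' i (insert x (A' i)) i' ↔ (i' = i ∧ y = x) ∨ y ∈ A' i' := by
      rcases eq_or_ne i' i with rfl | h <;> simp [*]
    refine ⟨Function.update A' i (insert x (A' i)), ?_, ?_, ?_, ?_⟩
    · intro i₁ i₂ y h₁ h₂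
      rw [hmem] at h₁ h₂
      rcases h₁ with ⟨rfl, rfl⟩ | h₁ <;> rcases h₂ with ⟨rfl, h⟩ | h₂
      · rfl
      · exact absurd h₂ (hx _)
      · exact absurd (h ▸ h₁) (hx _)
      · exact hd _ _ _ h₁ h₂
    · intro i'
      rcases eq_or_ne i' i with rfl | h
      · intro b
        rw [Function.update_self, Finset.filter_insert]
        split_ifs with hb
        · subst hb
          exact (Finset.card_insert_le _ _).trans hi
        · exact hf _ b
      · simpa [h] using hf i'
    · exact fun i' y hy => hmem.2 (Or.inr (hs i' hy))
    · intro y hy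
      rcases Finset.mem_insert.1 hy with rfl | hy
      · exact ⟨i, hmem.2 (Or.inl ⟨rfl, rfl⟩)⟩
      · obtain ⟨i', hi'⟩ := hc y hy
        exact ⟨i', hmem.2 (Or.inr hi')⟩

/-- The bundles of a partition split the value of any set of items. -/
lemma IsPartition.sum_sum_filter {M R : Type*} [Fintype M] [AddCommMonoid R] {n : ℕ}
    {A : Fin n → Finset M} (hA : IsPartition A) (p : M → Prop) [DecidablePred p] (v : M → R) :
    ∑ i, ∑ x ∈ (A i).filter p, v x = ∑ x ∈ univ.filter p, v x := by
  classical
  rw [← Finset.sum_biUnion]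
  · congr 1
    ext x
    obtain ⟨i, hi, -⟩ := hA x
    simp only [mem_biUnion, mem_univ, mem_filter, true_and]
    exact ⟨fun ⟨_, _, h⟩ => h, fun h => ⟨i, hi, h⟩⟩
  · intro i _ i' _ hii'
    refine Finset.disjoint_left.2 fun y hy hy' => hii' ?_
    exact (hA y).unique (Finset.mem_filter.1 hy).1 (Finset.mem_filter.1 hy').1

/-- The maximin share is at most `1` when the `n` agents share items of total value `n`. -/
lemma mms_le_one {M : Type*} [Fintype M] {n ℓ : ℕ} (hn : 0 < n) (cat : M → Fin ℓ)
    (k : Fin ℓ → ℕ) (v : M → ℝ) (hnorm : ∑ x, v x = (n : ℝ)) :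
    mms n cat k v ≤ 1 := by
  refine Real.sSup_le ?_ zero_le_one
  rintro x ⟨A, hA, rfl⟩
  have hsum : ∑ i, ∑ x ∈ A i, v x = (n : ℝ) := by
    simpa [hnorm] using hA.1.sum_sum_filter (fun _ => True) v
  have hle : n • (⨅ i, ∑ x ∈ A i, v x) ≤ ∑ i, ∑ x ∈ A i, v x := by
    simpa using Finset.card_nsmul_le_sum univ (fun i => ∑ x ∈ A i, v x) _
      fun i _ => ciInf_le (Set.finite_range _).bddBelow i
  rw [hsum, nsmul_eq_mul] at hle
  have hn' : (0 : ℝ) < n := by exact_mod_cast hn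
  nlinarith

lemma mms_nonneg {M : Type*} {n ℓ : ℕ} (cat : M → Fin ℓ)
    (k : Fin ℓ → ℕ) (v : M → ℝ) (hv : ∀ x, 0 ≤ v x) : 0 ≤ mms n cat k v := by
  refine Real.sSup_nonneg ?_
  rintro x ⟨A, -, rfl⟩
  exact Real.iInf_nonneg fun i => Finset.sum_nonneg fun x _ => hv x

lemma le_mms {M : Type*} [Finite M] {n ℓ : ℕ} {cat : M → Fin ℓ}
    {k : Fin ℓ → ℕ} {A : Fin n → Finset M} (hA : FeasibleAlloc cat k A) (v : M → ℝ) :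
    ⨅ i, ∑ x ∈ A i, v x ≤ mms n cat k v := by
  refine le_csSup (Set.Finite.bddAbove ?_) ⟨A, hA, rfl⟩
  refine (Set.finite_range fun A : Fin n → Finset M => ⨅ i, ∑ x ∈ A i, v x).subset ?_
  rintro x ⟨A, -, rfl⟩
  exact ⟨A, rfl⟩

/-- Trading the items of `B` for items of the bundle `A p` of the same category that are worth
at least as much leaves no other bundle worse off. -/
lemma exists_feasibleAlloc_compl_of_card_le {M : Type*} [Fintype M] [DecidableEq M] {n ℓ : ℕ}
    {cat : M → Fin ℓ} {k : Fin ℓ → ℕ} {A : Fin (n + 1) → Finset M} (hA : FeasibleAlloc cat k A)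
    (p : Fin (n + 1)) (B : Finset M) (v : M → ℝ) (hv : ∀ x, 0 ≤ v x)
    (hroom : ∀ h, (univ.filter (fun x : {x : M // x ∉ B} => cat x.1 = h)).card ≤ n * k h)
    (hle : ∀ h, (B.filter (fun x => cat x = h)).card ≤ ((A p).filter (fun x => cat x = h)).card)
    (hlow : ∀ x ∈ B \ A p, ∀ y ∈ A p \ B, cat y = cat x → v x ≤ v y) :
    ∃ A' : Fin n → Finset {x : M // x ∉ B}, FeasibleAlloc (fun x => cat x.1) k A' ∧
      ∀ i, ∑ x ∈ A (p.succAbove i), v x ≤ ∑ x ∈ A' i, v x.1 := by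
  obtain ⟨φ, hinj, hφ⟩ := exists_injOn_preserving_of_card_le cat (B \ A p) (A p \ B) (by
    intro h
    have e (S T : Finset M) : (S \ T).filter (fun x => cat x = h) =
        S.filter (fun x => cat x = h) \ T.filter (fun x => cat x = h) := by
      ext x
      simp only [mem_filter, mem_sdiff]
      tauto
    rw [e, e]
    have h₁ := Finset.card_sdiff_add_card_inter (B.filter (fun x => cat x = h))
      ((A p).filter (fun x => cat x = h))
    have h₂ := Finset.card_sdiff_add_card_inter ((A p).filter (fun x => cat x = h))
      (B.filter (fun x => cat x = h))
    rw [Finset.inter_comm] at h₂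
    have := hle h
    omega)
  have huniq {i i' : Fin (n + 1)} {x : M} (h : x ∈ A i) (h' : x ∈ A i') : i = i' :=
    (hA.1 x).unique h h'
  have hsub (i : Fin n) {x : M} (hx : x ∈ A (p.succAbove i) ∩ B) : x ∈ B \ A p := by
    rw [mem_inter] at hx
    exact mem_sdiff.2 ⟨hx.2, fun h => p.succAbove_ne i (huniq hx.1 h)⟩
  let D : Fin n → Finset M := fun i =>
    (A (p.succAbove i) \ B) ∪ (A (p.succAbove i) ∩ B).image φ
  have hDB (i : Fin n) : ∀ x ∈ D i, x ∉ B := by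
    intro x hx
    rcases mem_union.1 hx with hx | hx
    · exact (mem_sdiff.1 hx).2
    · obtain ⟨y, hy, rfl⟩ := mem_image.1 hx
      exact (mem_sdiff.1 (hφ y (hsub i hy)).1).2
  have himage {i i' : Fin n} {y : M} (hy : y ∈ A (p.succAbove i) ∩ B)
      (h : φ y ∈ A (p.succAbove i')) : False :=
    p.succAbove_ne i' (huniq h (mem_sdiff.1 (hφ y (hsub i hy)).1).1)
  have hDdisj : ∀ i i' x, x ∈ D i → x ∈ D i' → i = i' := by
    intro i i' x hx hx'
    apply p.succAbove_right_injective
    rcases mem_union.1 hx with hx | hx <;> rcases mem_union.1 hx' with hx' | hx'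
    · exact huniq (mem_sdiff.1 hx).1 (mem_sdiff.1 hx').1
    · obtain ⟨y, hy, rfl⟩ := mem_image.1 hx'
      exact (himage hy (mem_sdiff.1 hx).1).elim
    · obtain ⟨y, hy, rfl⟩ := mem_image.1 hx
      exact (himage hy (mem_sdiff.1 hx').1).elim
    · obtain ⟨y, hy, rfl⟩ := mem_image.1 hx
      obtain ⟨z, hz, hzy⟩ := mem_image.1 hx'
      obtain rfl := hinj (hsub i' hz) (hsub i hy) hzy
      exact huniq (mem_inter.1 hy).1 (mem_inter.1 hz).1
  have hDfeas (i : Fin n) : FeasibleBundle cat k (D i) := by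
    intro h
    have h₁ : ((D i).filter (fun x => cat x = h)) ⊆
        ((A (p.succAbove i) \ B).filter (fun x => cat x = h)) ∪
        ((A (p.succAbove i) ∩ B).filter (fun x => cat x = h)).image φ := by
      intro x hx
      obtain ⟨hx, hc⟩ := mem_filter.1 hx
      rcases mem_union.1 hx with hx | hx
      · exact mem_union_left _ (mem_filter.2 ⟨hx, hc⟩)
      · obtain ⟨y, hy, rfl⟩ := mem_image.1 hx
        exact mem_union_right _ (mem_image_of_mem _ (mem_filter.2
          ⟨hy, (hφ y (hsub i hy)).2.symm.trans hc⟩))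
    calc _ ≤ _ := card_le_card h₁
      _ ≤ _ := card_union_le _ _
      _ ≤ ((A (p.succAbove i) \ B).filter (fun x => cat x = h)).card +
          ((A (p.succAbove i) ∩ B).filter (fun x => cat x = h)).card :=
        Nat.add_le_add_left card_image_le _
      _ = ((A (p.succAbove i)).filter (fun x => cat x = h)).card := by
        rw [← card_union_of_disjoint
            (disjoint_filter_filter (disjoint_sdiff_inter (A (p.succAbove i)) B)),
          ← filter_union, sdiff_union_inter]
      _ ≤ k h := hA.2 _ h
  have hDsum (i : Fin n) : ∑ x ∈ A (p.succAbove i), v x ≤ ∑ x ∈ D i, v x := by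
    rw [sum_union, sum_image fun x hx y hy => hinj (hsub i hx) (hsub i hy)]
    · rw [← sdiff_union_inter (A (p.succAbove i)) B, sum_union (disjoint_sdiff_inter _ _),
        sdiff_union_inter]
      gcongr with x hx
      exact hlow x (hsub i hx) _ (hφ x (hsub i hx)).1 (hφ x (hsub i hx)).2
    · refine disjoint_left.2 fun x hx hx' => ?_
      obtain ⟨y, hy, rfl⟩ := mem_image.1 hx'
      exact himage hy (mem_sdiff.1 hx).1
  obtain ⟨A', hA', hDA'⟩ := exists_feasibleAlloc_extending
    (fun x : {x : M // x ∉ B} => cat x.1) k hroom (fun i => (D i).subtype (· ∉ B))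
    (fun i i' x hx hx' => hDdisj i i' x (mem_subtype.1 hx) (mem_subtype.1 hx'))
    (fun i h => by
      refine le_trans ?_ (hDfeas i h)
      refine card_le_card_of_injOn Subtype.val ?_ Subtype.val_injective.injOn
      intro x hx
      simpa using hx)
  refine ⟨A', hA', fun i => (hDsum i).trans ?_⟩
  rw [← sum_subtype_of_mem v (hDB i)]
  exact sum_le_sum_of_subset_of_nonneg (hDA' i) fun x _ _ => hv x.1

/-- Valid reduction. In a normalized ordered instance, if agent `i`
values item `j` at least `α > 0`, then the bundle `B` consisting of `j` together
with, for each category `h`, the `max (0, |C_h \ {j}| - (n-1)·k h)` least valuable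
items of `C_h \ {j}` is feasible, worth at least `α ≥ α·μ_i` to `i`, the reduced
instance (without agent `i` and the items of `B`) admits a feasible allocation,
and no remaining agent's maximin share decreases. -/
theorem stmt_7 {m ℓ n : ℕ} (hn : 2 ≤ n)
    (cat : Fin m → Fin ℓ) (k : Fin ℓ → ℕ)
    (v : Fin n → Fin m → ℝ) (hv : ∀ i j, 0 ≤ v i j)
    (hord : ∀ j j', cat j = cat j' →
      (∀ i, v i j ≤ v i j') ∨ (∀ i, v i j' ≤ v i j))
    (hcard : ∀ h, (univ.filter (fun x => cat x = h)).card ≤ n * k h)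
    (hnorm : ∀ i, ∑ j, v i j = (n : ℝ))
    (i : Fin n) (j : Fin m) (α : ℝ) (hα : 0 < α) (hij : α ≤ v i j)
    (B : Finset (Fin m)) (hjB : j ∈ B)
    (hBcard : ∀ h, ((B.erase j).filter (fun x => cat x = h)).card =
      (((univ.filter (fun x => cat x = h)).erase j)).card - (n - 1) * k h)
    (hBlow : ∀ x ∈ B.erase j, ∀ y, y ∉ B → y ≠ j → cat y = cat x →
      ∀ i', v i' x ≤ v i' y) :
    FeasibleBundle cat k B ∧
    α ≤ ∑ x ∈ B, v i x ∧
    α * mms n cat k (v i) ≤ ∑ x ∈ B, v i x ∧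
    (∃ A : Fin (n - 1) → Finset {x : Fin m // x ∉ B},
      FeasibleAlloc (fun x => cat x.1) k A) ∧
    ∀ i', i' ≠ i →
      mms n cat k (v i') ≤
        mms (n - 1) (fun x : {x : Fin m // x ∉ B} => cat x.1) k (fun x => v i' x.1) := by
  obtain ⟨t, rfl⟩ : ∃ t, n = t + 2 := ⟨n - 2, by omega⟩
  simp only [show t + 2 - 1 = t + 1 from rfl] at hBcard ⊢
  have hexp (h : Fin ℓ) : (t + 2) * k h = (t + 1) * k h + k h := by ring
  have hBcard' (h : Fin ℓ) : (B.filter (fun x => cat x = h)).card =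
      max (if cat j = h then 1 else 0)
        ((univ.filter (fun x => cat x = h)).card - (t + 1) * k h) := by
    have hB := hBcard h
    rw [filter_erase] at hB
    split_ifs with hj
    · have h₁ := card_erase_add_one (show j ∈ B.filter (fun x => cat x = h) by simp [hjB, hj])
      have h₂ := card_erase_add_one (show j ∈ univ.filter (fun x => cat x = h) by simp [hj])
      omega
    · rw [erase_eq_of_notMem (by simp [hj]), erase_eq_of_notMem (by simp [hj])] at hB
      omega
  have hfeas : FeasibleBundle cat k B := by
    intro h
    rw [hBcard' h]
    have h₁ := hcard h
    have h₂ := hexp h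
    split_ifs with hj
    · have hpos : 0 < (univ.filter (fun x => cat x = h)).card :=
        card_pos.2 ⟨j, by simp [hj]⟩
      have : 0 < k h := Nat.pos_of_mul_pos_left (hpos.trans_le h₁)
      omega
    · omega
  have hval : α ≤ ∑ x ∈ B, v i x :=
    hij.trans (single_le_sum (fun x _ => hv i x) hjB)
  have hroom (h : Fin ℓ) :
      (univ.filter (fun x : {x : Fin m // x ∉ B} => cat x.1 = h)).card ≤ (t + 1) * k h := by
    have h₁ : (univ.filter (fun x : {x : Fin m // x ∉ B} => cat x.1 = h)).card ≤
        (univ.filter (fun x => cat x = h) \ B.filter (fun x => cat x = h)).card := by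
      refine card_le_card_of_injOn Subtype.val ?_ Subtype.val_injective.injOn
      intro x hx
      simpa [x.2] using hx
    rw [card_sdiff_of_subset (filter_subset_filter _ (subset_univ B)), hBcard' h] at h₁
    omega
  refine ⟨hfeas, hval, ?_, ?_, ?_⟩
  · refine le_trans ?_ hval
    have := mms_le_one (by omega) cat k (v i) (hnorm i)
    nlinarith
  · obtain ⟨A, hA, -⟩ := exists_feasibleAlloc_extending
      (fun x : {x : Fin m // x ∉ B} => cat x.1) k hroom (fun _ => ∅) (by simp)
      (fun _ h => by simp)
    exact ⟨A, hA⟩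
  · intro i' _
    refine Real.sSup_le ?_ (mms_nonneg _ _ _ fun x => hv i' x.1)
    rintro x ⟨A, hA, rfl⟩
    obtain ⟨p, hp, -⟩ := hA.1 j
    obtain ⟨A', hA', hle⟩ := exists_feasibleAlloc_compl_of_card_le hA p B (v i') (hv i') hroom
      (by
        intro h
        rw [hBcard' h]
        refine max_le ?_ ?_
        · split_ifs with hj
          · exact card_pos.2 ⟨j, by simp [hp, hj]⟩
          · exact Nat.zero_le _
        · have h₁ := hA.1.sum_sum_filter (fun x => cat x = h) (fun _ => 1)
          simp only [← card_eq_sum_ones] at h₁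
          rw [Fin.sum_univ_succAbove _ p] at h₁
          have h₂ : ∑ q, ((A (p.succAbove q)).filter (fun x => cat x = h)).card ≤
              (t + 1) * k h := by
            simpa using sum_le_card_nsmul univ _ _ fun q _ => hA.2 (p.succAbove q) h
          omega)
      (by
        intro x hx y hy hxy
        rw [mem_sdiff] at hx hy
        refine hBlow x (mem_erase.2 ⟨?_, hx.1⟩) y hy.2 ?_ hxy i'
        · rintro rfl
          exact hx.2 hp
        · rintro rfl
          exact hy.2 hjB)
    refine le_trans (le_ciInf fun q => ?_) (le_mms hA' _)
    exact (ciInf_le (Set.finite_range _).bddBelow (p.succAbove q)).trans (hle q)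
end

section
/- Let I be an instance of fair allocation under cardinality constraints with n ≥ 2 agents and |C_h| ≤ n·k_h for all h, let j ∈ M be any item, and let B consist of j together with, for each category C_h, any max(0, |C_h \ {j}| − (n−1)·k_h) items of C_h \ {j}. Then B contains at most k_h items from each category C_h (so B is feasible), and after removing B every category contains at most (n−1)·k_h items, so the reduced instance on the remaining items with n−1 agents admits a feasible allocation. -/
open Finset

/-- If every category holds at most `n * k h` items, then a feasible allocation to `n` agents
exists. -/
theorem exists_feasibleAlloc {M : Type*} [Fintype M] {n ℓ : ℕ} (cat : M → Fin ℓ)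
    (k : Fin ℓ → ℕ) (hcard : ∀ h, (univ.filter (fun x => cat x = h)).card ≤ n * k h) :
    ∃ A : Fin n → Finset M, FeasibleAlloc cat k A := by
  have hemb (h : Fin ℓ) : Nonempty ({x // cat x = h} ↪ Fin n × Fin (k h)) :=
    Function.Embedding.nonempty_of_card_le (by
      simpa [Fintype.card_subtype] using hcard h)
  let e (h : Fin ℓ) := (hemb h).some
  refine ⟨fun i => univ.filter (fun x => (e (cat x) ⟨x, rfl⟩).1 = i),
    fun x => ⟨(e (cat x) ⟨x, rfl⟩).1, by simp, fun i hi =>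
      (mem_filter.mp hi).2.symm⟩, fun i h => ?_⟩
  have hfst {x : M} (hx : cat x = h) : (e (cat x) ⟨x, rfl⟩).1 = (e h ⟨x, hx⟩).1 := by
    subst hx; rfl
  rw [← Fintype.card_fin (k h), ← Fintype.card_coe]
  refine Fintype.card_le_of_injective
    (fun x => (e h ⟨x.1, (mem_filter.mp x.2).2⟩).2) fun x y hxy => ?_
  have hx := mem_filter.mp x.2
  have hy := mem_filter.mp y.2
  have hxi := (hfst hx.2).symm.trans (mem_filter.mp hx.1).2
  have hyi := (hfst hy.2).symm.trans (mem_filter.mp hy.1).2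
  exact Subtype.ext (Subtype.mk.inj ((e h).injective (Prod.ext (hxi.trans hyi.symm) hxy)))

/-- Any bundle `B` consisting of an item `j` together with, for each
category `h`, any `max (0, |C_h \ {j}| - (n-1)·k h)` items of `C_h \ {j}` is
feasible, and after removing `B` every category has at most `(n-1)·k h` items, so
the reduced instance with `n - 1` agents admits a feasible allocation. -/
theorem stmt_8 {m ℓ n : ℕ} (hn : 2 ≤ n)
    (cat : Fin m → Fin ℓ) (k : Fin ℓ → ℕ)
    (hcard : ∀ h, (univ.filter (fun x => cat x = h)).card ≤ n * k h)
    (j : Fin m) (B : Finset (Fin m)) (hjB : j ∈ B)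
    (hBcard : ∀ h, ((B.erase j).filter (fun x => cat x = h)).card =
      (((univ.filter (fun x => cat x = h)).erase j)).card - (n - 1) * k h) :
    (∀ h, (B.filter (fun x => cat x = h)).card ≤ k h) ∧
    (∀ h, ((univ.filter (fun x => cat x = h)) \ B).card ≤ (n - 1) * k h) ∧
    ∃ A : Fin (n - 1) → Finset {x : Fin m // x ∉ B},
      FeasibleAlloc (fun x => cat x.1) k A := by
  have hsdiff (h : Fin ℓ) : ((univ.filter (fun x => cat x = h)) \ B).card +
      (B.filter (fun x => cat x = h)).card = (univ.filter (fun x => cat x = h)).card := by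
    rw [← card_sdiff_add_card_inter (univ.filter (fun x => cat x = h)) B, filter_inter,
      univ_inter]
  have hmul (h : Fin ℓ) : n * k h = (n - 1) * k h + k h := by
    rw [← Nat.succ_mul, Nat.succ_eq_add_one, Nat.sub_add_cancel (by omega)]
  have hbounds (h : Fin ℓ) : (B.filter (fun x => cat x = h)).card ≤ k h ∧
      ((univ.filter (fun x => cat x = h)) \ B).card ≤ (n - 1) * k h := by
    have hB := hBcard h
    have hC := hcard h
    have hS := hsdiff h
    rw [hmul] at hC
    rw [filter_erase] at hB
    by_cases hj : cat j = h
    · have hjC : j ∈ univ.filter (fun x => cat x = h) := by simp [hj]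
      have hjB' : j ∈ B.filter (fun x => cat x = h) := by simp [hj, hjB]
      have hk : 0 < k h := by
        by_contra hk
        have := card_pos.mpr ⟨j, hjC⟩
        simp only [Nat.eq_zero_of_not_pos hk, mul_zero] at hC
        omega
      have := card_erase_add_one hjC
      have := card_erase_add_one hjB'
      omega
    · rw [erase_eq_of_notMem (by simp [hj]), erase_eq_of_notMem (by simp [hj])] at hB
      omega
  refine ⟨fun h => (hbounds h).1, fun h => (hbounds h).2,
    exists_feasibleAlloc _ k fun h => le_trans ?_ (hbounds h).2⟩
  exact card_le_card_of_injOn Subtype.val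
    (fun x hx => by simpa [x.2] using hx) Subtype.val_injective.injOn
end

section
/- Every instance of fair allocation under cardinality constraints with |C_h| ≤ n·k_h for all categories h admits a feasible allocation A = (A_1, …, A_n) such that v_i(A_i) ≥ μ_i/2 for every agent i; that is, a feasible 1/2-approximate MMS allocation always exists. -/
open Finset

/-- If every value on `X` dominates every value on `Y`, the sums compare like the cardinalities. -/
lemma mul_sum_le_mul_sum_of_dominated {M : Type*} (w : M → ℝ) {X Y : Finset M} {a b : ℕ}
    (hX : ∀ x ∈ X, 0 ≤ w x) (h : ∀ x ∈ X, ∀ y ∈ Y, w y ≤ w x) (hc : a * #Y ≤ b * #X) :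
    (a : ℝ) * ∑ y ∈ Y, w y ≤ b * ∑ x ∈ X, w x := by
  rcases X.eq_empty_or_nonempty with rfl | hne
  · have hc' : a = 0 ∨ Y = ∅ := by simpa using hc
    rcases hc' with rfl | rfl <;> simp
  · obtain ⟨x₀, hx₀, hmin⟩ := X.exists_min_image w hne
    have h1 : ∑ y ∈ Y, w y ≤ #Y * w x₀ := by
      simpa using Y.sum_le_card_nsmul w (w x₀) (h x₀ hx₀)
    have h2 : #X * w x₀ ≤ ∑ x ∈ X, w x := by
      simpa using X.card_nsmul_le_sum w (w x₀) hmin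
    have hc' : (a : ℝ) * #Y ≤ b * #X := by exact_mod_cast hc
    calc (a : ℝ) * ∑ y ∈ Y, w y ≤ a * (#Y * w x₀) := by gcongr
      _ = a * #Y * w x₀ := by ring
      _ ≤ b * #X * w x₀ := mul_le_mul_of_nonneg_right hc' (hX x₀ hx₀)
      _ = b * (#X * w x₀) := by ring
      _ ≤ b * ∑ x ∈ X, w x := by gcongr

/-- The `N` smallest elements of a finite set. -/
lemma exists_initial_subset {M : Type*} [LinearOrder M] (S : Finset M) (N : ℕ) :
    ∃ U ⊆ S, #U = min N #S ∧ ∀ x ∈ U, ∀ y ∈ S \ U, x ≤ y := by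
  induction N with
  | zero => exact ⟨∅, by simp⟩
  | succ N ih =>
    obtain ⟨U, hUS, hU, hle⟩ := ih
    rcases (S \ U).eq_empty_or_nonempty with he | hne
    · have : U = S := hUS.antisymm (sdiff_eq_empty_iff_subset.mp he)
      subst this
      exact ⟨U, hUS, by omega, hle⟩
    · obtain ⟨z, hz, hmin⟩ := (S \ U).exists_min_image id hne
      have hz' := mem_sdiff.mp hz
      refine ⟨insert z U, insert_subset hz'.1 hUS, ?_, ?_⟩
      · have : #U < #S := card_lt_card ⟨hUS, fun h => hz'.2 (h hz'.1)⟩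
        rw [card_insert_of_notMem hz'.2]
        omega
      · intro x hx y hy
        simp only [mem_insert, mem_sdiff, not_or] at hx hy
        have hy' : y ∈ S \ U := mem_sdiff.mpr ⟨hy.1, hy.2.2⟩
        rcases hx with rfl | hx
        · exact hmin y hy'
        · exact hle x hx y hy'

/-- The `N h` smallest elements of a finite set in each category `h`. -/
lemma exists_initial_subset_of_categories {M : Type*} [LinearOrder M] {ℓ : ℕ} (cat : M → Fin ℓ)
    (S : Finset M) (N : Fin ℓ → ℕ) :
    ∃ U ⊆ S, (∀ h, #{x ∈ U | cat x = h} = min (N h) #{x ∈ S | cat x = h}) ∧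
      ∀ x ∈ U, ∀ y ∈ S \ U, cat x = cat y → x ≤ y := by
  choose U hUS hU hle using fun h => exists_initial_subset {x ∈ S | cat x = h} (N h)
  refine ⟨{x ∈ S | x ∈ U (cat x)}, filter_subset _ _, fun h => ?_, fun x hx y hy hxy => ?_⟩
  · rw [← hU h]
    congr 1
    ext x
    constructor
    · intro hx
      simp only [mem_filter] at hx
      exact hx.2 ▸ hx.1.2
    · intro hx
      have := mem_filter.mp (hUS h hx)
      simp only [mem_filter]
      exact ⟨⟨this.1, this.2.symm ▸ hx⟩, this.2⟩
  · simp only [mem_filter, mem_sdiff, not_and] at hx hy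
    refine hle (cat x) x hx.2 y ?_
    simp only [mem_sdiff, mem_filter]
    exact ⟨⟨hy.1, hxy.symm⟩, hxy ▸ hy.2 hy.1⟩

lemma sum_le_sum_of_categories {M : Type*} {ℓ : ℕ} (cat : M → Fin ℓ) (w : M → ℝ)
    {X Y : Finset M} {a b : ℕ}
    (h : ∀ c, (a : ℝ) * ∑ y ∈ Y with cat y = c, w y ≤ b * ∑ x ∈ X with cat x = c, w x) :
    (a : ℝ) * ∑ y ∈ Y, w y ≤ b * ∑ x ∈ X, w x := by
  rw [← sum_fiberwise Y cat w, ← sum_fiberwise X cat w, mul_sum, mul_sum]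
  exact sum_le_sum fun c _ => h c

lemma FeasibleBundle.map {M : Type*} {ℓ : ℕ} {cat : M → Fin ℓ} {k : Fin ℓ → ℕ}
    {B : Finset M} (hB : FeasibleBundle cat k B) (e : M ↪ M) (he : ∀ x, cat (e x) = cat x) :
    FeasibleBundle cat k (B.map e) := by
  intro c
  rw [filter_map, card_map]
  simpa only [Function.comp_def, he] using hB c

/-- Disjoint feasible bundles extend to a feasible allocation. -/
lemma exists_feasibleAlloc_of_disjoint {M : Type*} [Fintype M] [DecidableEq M] {n ℓ : ℕ}
    {cat : M → Fin ℓ} {k : Fin ℓ → ℕ} (hcard : ∀ h, #{x | cat x = h} ≤ n * k h)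
    (B : Fin n → Finset M) (hB : ∀ i, FeasibleBundle cat k (B i))
    (hd : ∀ i j, i ≠ j → Disjoint (B i) (B j)) :
    ∃ A : Fin n → Finset M, FeasibleAlloc cat k A ∧ ∀ i, B i ⊆ A i := by
  obtain ⟨A, hBA, hA⟩ := Finite.exists_le_maximal (a := B)
    (p := fun A => (∀ i, FeasibleBundle cat k (A i)) ∧ ∀ i j, i ≠ j → Disjoint (A i) (A j))
    ⟨hB, hd⟩
  refine ⟨A, ⟨fun x => ?_, hA.prop.1⟩, hBA⟩
  have hex : ∃ i, x ∈ A i := by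
    by_contra! hx
    have hfull : ∀ i, k (cat x) ≤ #{y ∈ A i | cat y = cat x} := by
      intro i
      by_contra! hlt
      have hgood : (∀ j, FeasibleBundle cat k (Function.update A i (insert x (A i)) j)) ∧
          ∀ j l, j ≠ l → Disjoint (Function.update A i (insert x (A i)) j)
            (Function.update A i (insert x (A i)) l) := by
        constructor
        · intro j
          rcases eq_or_ne j i with rfl | hj
          · rw [Function.update_self]
            intro c
            rw [filter_insert]
            split_ifs with hc
            · subst hc
              exact (card_insert_le _ _).trans hlt
            · exact hA.prop.1 j c
          · rw [Function.update_of_ne hj]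
            exact hA.prop.1 j
        · intro j l hjl
          have := hA.prop.2 j l hjl
          rcases eq_or_ne j i with rfl | hj
          · rw [Function.update_self, Function.update_of_ne hjl.symm]
            exact disjoint_insert_left.mpr ⟨hx l, this⟩
          · rw [Function.update_of_ne hj]
            rcases eq_or_ne l i with rfl | hl
            · rw [Function.update_self]
              exact disjoint_insert_right.mpr ⟨hx j, this⟩
            · rwa [Function.update_of_ne hl]
      have hle : A ≤ Function.update A i (insert x (A i)) :=
        le_update_self_iff.mpr (subset_insert _ _)
      have := hA.le_of_ge hgood hle i
      rw [Function.update_self] at this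
      exact hx i (this (mem_insert_self _ _))
    have hsub : insert x (univ.biUnion fun i => {y ∈ A i | cat y = cat x}) ⊆
        ({y | cat y = cat x} : Finset M) := by
      intro y hy
      simp only [mem_insert, mem_biUnion, mem_filter, mem_univ, true_and] at hy ⊢
      rcases hy with rfl | ⟨_, _, h⟩
      · rfl
      · exact h
    have h1 := card_le_card hsub
    rw [card_insert_of_notMem (by simp [hx]), card_biUnion fun i _ j _ hij =>
      disjoint_filter_filter (hA.prop.2 i j hij)] at h1
    have h2 : n * k (cat x) ≤ ∑ i, #{y ∈ A i | cat y = cat x} := by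
      simpa using card_nsmul_le_sum univ (fun i => #{y ∈ A i | cat y = cat x}) _
        fun i _ => hfull i
    have := hcard (cat x)
    omega
  obtain ⟨i, hi⟩ := hex
  refine ⟨i, hi, fun j hj => ?_⟩
  by_contra hne
  exact disjoint_left.mp (hA.prop.2 j i hne) hj hi

/-- The maximin share is attained. -/
lemma exists_feasibleAlloc_mms_le {M : Type*} [Fintype M] [DecidableEq M] {n ℓ : ℕ}
    {cat : M → Fin ℓ} {k : Fin ℓ → ℕ} (hcard : ∀ h, #{x | cat x = h} ≤ n * k h) (v : M → ℝ) :
    ∃ A : Fin n → Finset M, FeasibleAlloc cat k A ∧ ∀ i, mms n cat k v ≤ ∑ j ∈ A i, v j := by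
  have hne : {x | ∃ A : Fin n → Finset M, FeasibleAlloc cat k A ∧
      x = ⨅ i, ∑ j ∈ A i, v j}.Nonempty := by
    obtain ⟨A, hA, -⟩ := exists_feasibleAlloc_of_disjoint hcard (fun _ => ∅)
      (fun _ c => by simp) (fun _ _ _ => disjoint_empty_left _)
    exact ⟨_, A, hA, rfl⟩
  have hfin : {x | ∃ A : Fin n → Finset M, FeasibleAlloc cat k A ∧
      x = ⨅ i, ∑ j ∈ A i, v j}.Finite := by
    refine (Set.finite_range fun A : Fin n → Finset M => ⨅ i, ∑ j ∈ A i, v j).subset ?_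
    rintro x ⟨A, -, rfl⟩
    exact ⟨A, rfl⟩
  obtain ⟨A, hA, hx⟩ := hne.csSup_mem hfin
  refine ⟨A, hA, fun i => ?_⟩
  rw [mms, hx]
  exact ciInf_le (Set.finite_range _).bddBelow i

/-- Every valuation can be made decreasing within each category by a category-preserving
permutation of the items. -/
lemma exists_perm_antitone_on_categories {m ℓ : ℕ} (cat : Fin m → Fin ℓ) (v : Fin m → ℝ) :
    ∃ σ : Equiv.Perm (Fin m), (∀ x, cat (σ x) = cat x) ∧
      ∀ x y, cat x = cat y → x ≤ y → v (σ y) ≤ v (σ x) := by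
  set f : Fin m → Fin ℓ ×ₗ Fin m := fun x => toLex (cat x, x)
  set g : Fin m → Fin ℓ ×ₗ ℝ := fun x => toLex (cat x, -v x)
  set τ := Tuple.sort f
  set ρ := Tuple.sort g
  have hf : Monotone (f ∘ τ) := Tuple.monotone_sort f
  have hg : Monotone (g ∘ ρ) := Tuple.monotone_sort g
  have hfst : ∀ {α : Type} [LinearOrder α], Monotone fun p : Fin ℓ ×ₗ α => (ofLex p).1 :=
    fun {_} _ => Prod.Lex.monotone_fst_ofLex
  have hcf : Monotone (cat ∘ τ) := hfst.comp hf
  have hcg : Monotone (cat ∘ ρ) := hfst.comp hg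
  have heq : cat ∘ τ = cat ∘ ρ := Tuple.unique_monotone hcf hcg
  refine ⟨τ.symm.trans ρ, fun x => ?_, fun x y hxy hle => ?_⟩
  · simpa using (congrFun heq (τ.symm x)).symm
  · have hle' : τ.symm x ≤ τ.symm y := by
      by_contra! hlt
      have := hf hlt.le
      simp only [f, Function.comp_apply, Equiv.apply_symm_apply, Prod.Lex.toLex_le_toLex] at this
      rcases this with h | ⟨-, h⟩
      · exact h.ne hxy.symm
      · exact hlt.ne (congrArg τ.symm (le_antisymm h hle))
    have h := hg hle'
    have hx := congrFun heq (τ.symm x)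
    have hy := congrFun heq (τ.symm y)
    simp only [Function.comp_apply, Equiv.apply_symm_apply] at hx hy
    simp only [g, Function.comp_apply, Prod.Lex.toLex_le_toLex] at h
    rcases h with h | ⟨-, h⟩
    · exact absurd (hx ▸ hy ▸ hxy) h.ne
    · simpa using h

/-- Letting the owners of the positions pick in increasing order, each owner obtains an item
at least as good as the one that his own ordering puts in that position. -/
lemma exists_embedding_le_of_owner {m n ℓ : ℕ} (cat : Fin m → Fin ℓ) (v : Fin n → Fin m → ℝ)
    (σ : Fin n → Equiv.Perm (Fin m)) (hσ : ∀ i x, cat (σ i x) = cat x)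
    (hanti : ∀ i x y, cat x = cat y → x ≤ y → v i (σ i y) ≤ v i (σ i x)) (o : Fin m → Fin n) :
    ∃ e : Fin m ↪ Fin m, (∀ x, cat (e x) = cat x) ∧
      ∀ x, v (o x) (σ (o x) x) ≤ v (o x) (e x) := by
  have key : ∀ t : ℕ, ∃ e : Fin m → Fin m, (∀ x, cat (e x) = cat x) ∧
      (∀ x, v (o x) (σ (o x) x) ≤ v (o x) (e x)) ∧
      ∀ x y : Fin m, x.val < t → y.val < t → e x = e y → x = y := by
    intro t
    induction t with
    | zero => exact ⟨fun x => σ (o x) x, fun x => hσ _ _, fun x => le_rfl, by simp⟩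
    | succ t ih =>
      obtain ⟨e, hcat, hle, hinj⟩ := ih
      by_cases ht : t < m
      swap
      · exact ⟨e, hcat, hle, fun x y _ _ => hinj x y (by omega) (by omega)⟩
      set z : Fin m := ⟨t, ht⟩
      set P : Finset (Fin m) := {x | x < z ∧ cat x = cat z}
      have hzP : z ∉ P := by simp [P]
      obtain ⟨y, hy, hyP⟩ : ∃ y ∈ (insert z P).image (σ (o z)), y ∉ P.image e := by
        refine exists_mem_notMem_of_card_lt_card ?_
        rw [card_image_of_injective _ (σ (o z)).injective, card_insert_of_notMem hzP]
        exact Nat.lt_succ_of_le card_image_le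
      obtain ⟨x, hx, rfl⟩ := mem_image.mp hy
      have hx' : x ≤ z ∧ cat x = cat z := by
        rcases mem_insert.mp hx with rfl | hx
        · exact ⟨le_rfl, rfl⟩
        · have := (mem_filter.mp hx).2
          exact ⟨this.1.le, this.2⟩
      have hnew : ∀ a : Fin m, a.val < t → e a ≠ σ (o z) x := by
        intro a ha h
        refine hyP (mem_image.mpr ⟨a, mem_filter.mpr ⟨mem_univ _, ha, ?_⟩, h⟩)
        rw [← hcat a, h, hσ, hx'.2]
      refine ⟨Function.update e z (σ (o z) x), fun a => ?_, fun a => ?_, fun a b ha hb => ?_⟩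
      · rcases eq_or_ne a z with rfl | h
        · rw [Function.update_self, hσ, hx'.2]
        · rw [Function.update_of_ne h, hcat]
      · rcases eq_or_ne a z with rfl | h
        · rw [Function.update_self]
          exact hanti _ _ _ hx'.2 hx'.1
        · rw [Function.update_of_ne h]
          exact hle a
      · have hlt : ∀ c : Fin m, c.val < t + 1 → c ≠ z → c.val < t := by
          intro c hc hne
          have : c.val ≠ t := fun h => hne (Fin.ext h)
          omega
        rcases eq_or_ne a z with rfl | h <;> rcases eq_or_ne b z with rfl | h'
        · exact fun _ => rfl
        · rw [Function.update_self, Function.update_of_ne h']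
          exact fun hab => absurd hab.symm (hnew b (hlt b hb h'))
        · rw [Function.update_self, Function.update_of_ne h]
          exact fun hab => absurd hab (hnew a (hlt a ha h))
        · rw [Function.update_of_ne h, Function.update_of_ne h']
          exact hinj a b (hlt a ha h) (hlt b hb h')
  obtain ⟨e, hcat, hle, hinj⟩ := key m
  exact ⟨⟨e, fun x y => hinj x y x.2 y.2⟩, hcat, hle⟩

section Ordered

variable {M ι : Type*} {ℓ : ℕ} {cat : M → Fin ℓ}
  {k : Fin ℓ → ℕ} {w : ι → M → ℝ} {μ : ι → ℝ}

/-- Feasible pairwise disjoint bundles inside `S`, worth at least `μ i / 2` to every `i ∈ T`. -/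
def HasHalfPacking (cat : M → Fin ℓ) (k : Fin ℓ → ℕ) (w : ι → M → ℝ) (μ : ι → ℝ)
    (T : Finset ι) (S : Finset M) : Prop :=
  ∃ B : ι → Finset M, (∀ i ∈ T, B i ⊆ S ∧ FeasibleBundle cat k (B i) ∧
    μ i / 2 ≤ ∑ x ∈ B i, w i x) ∧ ∀ i ∈ T, ∀ j ∈ T, i ≠ j → Disjoint (B i) (B j)

lemma HasHalfPacking.mono {T : Finset ι} {S S' : Finset M} (h : HasHalfPacking cat k w μ T S)
    (hS : S ⊆ S') : HasHalfPacking cat k w μ T S' := by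
  obtain ⟨B, hB, hd⟩ := h
  exact ⟨B, fun i hi => ⟨(hB i hi).1.trans hS, (hB i hi).2⟩, hd⟩

variable [LinearOrder M]

/-- Hand a bundle to one agent and continue with the remaining agents and items. -/
lemma HasHalfPacking.of_erase [DecidableEq ι] {T : Finset ι} {S B : Finset M} {i : ι} (hBS : B ⊆ S)
    (hB : FeasibleBundle cat k B) (hi : μ i / 2 ≤ ∑ x ∈ B, w i x)
    (h : HasHalfPacking cat k w μ (T.erase i) (S \ B)) : HasHalfPacking cat k w μ T S := by
  obtain ⟨C, hC, hd⟩ := h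
  refine ⟨Function.update C i B, fun j hj => ?_, fun j hj l hl hjl => ?_⟩
  · rcases eq_or_ne j i with rfl | hne
    · rw [Function.update_self]
      exact ⟨hBS, hB, hi⟩
    · rw [Function.update_of_ne hne]
      have := hC j (mem_erase.mpr ⟨hne, hj⟩)
      exact ⟨this.1.trans sdiff_subset, this.2⟩
  · have hdis : ∀ l ∈ T, l ≠ i → Disjoint B (C l) := fun l hl hne =>
      disjoint_of_subset_right (hC l (mem_erase.mpr ⟨hne, hl⟩)).1 disjoint_sdiff
    rcases eq_or_ne j i with rfl | hne
    · rw [Function.update_self, Function.update_of_ne hjl.symm]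
      exact hdis l hl hjl.symm
    · rw [Function.update_of_ne hne]
      rcases eq_or_ne l i with rfl | hne'
      · rw [Function.update_self]
        exact (hdis j hj hne).symm
      · rw [Function.update_of_ne hne']
        exact hd j (mem_erase.mpr ⟨hne, hj⟩) l (mem_erase.mpr ⟨hne', hl⟩) hjl

/-- Some bundle can be handed out, leaving enough items for everybody else. -/
lemma exists_bag (hw : ∀ i x, 0 ≤ w i x)
    (hanti : ∀ i x y, cat x = cat y → x ≤ y → w i y ≤ w i x) {T : Finset ι} {S : Finset M} {n : ℕ}
    (hT : T.Nonempty) (hS : ∀ h, #{x ∈ S | cat x = h} ≤ (n + 1) * k h)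
    (hsum : ∀ i ∈ T, (n + 1 : ℝ) * μ i ≤ ∑ x ∈ S, w i x)
    (hsmall : ∀ i ∈ T, ∀ x ∈ S, w i x ≤ μ i / 2) :
    ∃ B ⊆ S, FeasibleBundle cat k B ∧ (∀ h, #{x ∈ S \ B | cat x = h} ≤ n * k h) ∧
      (∀ i ∈ T, n * μ i ≤ ∑ x ∈ S \ B, w i x) ∧ ∃ i ∈ T, μ i / 2 ≤ ∑ x ∈ B, w i x := by
  classical
  obtain ⟨i₀, hi₀⟩ := hT
  set good : Finset (Finset M) := {B ∈ S.powerset | FeasibleBundle cat k B ∧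
    (∀ h, #{x ∈ S \ B | cat x = h} ≤ n * k h) ∧ ∀ i ∈ T, n * μ i ≤ ∑ x ∈ S \ B, w i x}
    with hgood
  have hne : good.Nonempty := by
    obtain ⟨U, hUS, hU, hle⟩ := exists_initial_subset_of_categories cat S fun h => n * k h
    have hcard : ∀ h, #{x ∈ S \ U | cat x = h} = #{x ∈ S | cat x = h} - n * k h := by
      intro h
      have h1 : ({x ∈ S \ U | cat x = h} : Finset M) =
          {x ∈ S | cat x = h} \ {x ∈ U | cat x = h} := by
        ext x
        simp only [mem_filter, mem_sdiff]
        tauto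
      rw [h1, card_sdiff_of_subset (filter_subset_filter _ hUS), hU]
      omega
    refine ⟨S \ U, ?_⟩
    simp only [hgood, mem_filter, mem_powerset, Finset.sdiff_sdiff_eq_self hUS]
    refine ⟨sdiff_subset, fun h => ?_, fun h => ?_, fun i hi => ?_⟩
    · rw [hcard]
      have := hS h
      rw [add_mul] at this
      omega
    · rw [hU]
      exact min_le_left _ _
    · have h1 : (n : ℝ) * ∑ x ∈ S \ U, w i x ≤ (1 : ℕ) * ∑ x ∈ U, w i x := by
        refine sum_le_sum_of_categories cat _ fun c => ?_
        refine mul_sum_le_mul_sum_of_dominated _ (fun x _ => hw i x) (fun x hx y hy => ?_) ?_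
        · rw [mem_filter] at hx hy
          have hxy := hx.2.trans hy.2.symm
          exact hanti i x y hxy (hle x hx.1 y hy.1 hxy)
        · rw [hcard, hU, one_mul]
          have := hS c
          rcases le_total #{x ∈ S | cat x = c} (n * k c) with h | h
          · simp [Nat.sub_eq_zero_of_le h]
          · rw [min_eq_left h]
            rw [add_mul] at this
            exact Nat.mul_le_mul_left _ (by omega)
      have h2 := sum_sdiff (f := w i) hUS
      have h3 := hsum i hi
      have h4 : (n : ℝ) * ((n + 1) * μ i) ≤ n * ∑ x ∈ S, w i x := by gcongr
      rw [← h2, mul_add] at h4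
      push_cast at h1
      have h5 : ((n : ℝ) + 1) * (n * μ i) ≤ (n + 1) * ∑ x ∈ U, w i x := by linarith
      exact le_of_mul_le_mul_left h5 (by positivity)
  obtain ⟨B, hB, hmax⟩ := good.exists_max_image (fun B => ∑ x ∈ B, w i₀ x) hne
  have hB' := (mem_filter.mp hB).2
  have hBS : B ⊆ S := mem_powerset.mp (mem_filter.mp hB).1
  refine ⟨B, hBS, hB'.1, hB'.2.1, hB'.2.2, ?_⟩
  by_contra! hlow
  have hgood_of : ∀ C ⊆ S, FeasibleBundle cat k C →
      (∀ h, #{x ∈ S \ C | cat x = h} ≤ n * k h) →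
      (∃ x ∈ S, ∀ i, ∑ y ∈ C, w i y ≤ ∑ y ∈ B, w i y + w i x) → C ∈ good := by
    rintro C hCS hC hcard ⟨x, hx, hle⟩
    refine mem_filter.mpr ⟨mem_powerset.mpr hCS, hC, hcard, fun i hi => ?_⟩
    have h1 := sum_sdiff (f := w i) hCS
    have h2 := hle i
    have h3 := hlow i hi
    have h4 := hsmall i hi x hx
    have h5 := hsum i hi
    linarith
  have hfree : ∀ x ∈ S \ B, #{y ∈ B | cat y = cat x} < k (cat x) → w i₀ x = 0 := by
    intro x hx hlt
    have hx' := mem_sdiff.mp hx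
    have hmem : insert x B ∈ good := by
      refine hgood_of _ (insert_subset hx'.1 hBS) (fun c => ?_) (fun c => ?_)
        ⟨x, hx'.1, fun i => ?_⟩
      · rw [filter_insert]
        split_ifs with hc
        · subst hc
          exact (card_insert_le _ _).trans hlt
        · exact hB'.1 c
      · refine (card_le_card (filter_subset_filter _ ?_)).trans (hB'.2.1 c)
        exact sdiff_subset_sdiff le_rfl (subset_insert _ _)
      · rw [sum_insert hx'.2, add_comm]
    have := hmax _ hmem
    simp only [sum_insert hx'.2] at this
    exact le_antisymm (by linarith) (hw _ _)
  have hswap : ∀ x ∈ S \ B, ∀ y ∈ B, cat x = cat y → w i₀ x ≤ w i₀ y := by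
    intro x hx y hy hxy
    have hx' := mem_sdiff.mp hx
    have hxe : x ∉ B.erase y := fun h => hx'.2 (mem_of_mem_erase h)
    have hval : ∀ i, ∑ z ∈ insert x (B.erase y), w i z = ∑ z ∈ B, w i z + w i x - w i y := by
      intro i
      rw [sum_insert hxe, ← sum_erase_add B (w i) hy]
      ring
    have hyS := hBS hy
    have hne : x ≠ y := fun h => hx'.2 (h ▸ hy)
    have hmem : insert x (B.erase y) ∈ good := by
      refine hgood_of _ (insert_subset hx'.1 ((erase_subset _ _).trans hBS)) (fun c => ?_)
        (fun c => ?_) ⟨x, hx'.1, fun i => by rw [hval]; linarith [hw i y]⟩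
      · rw [filter_insert, filter_erase]
        split_ifs with hc
        · have hyc : y ∈ ({z ∈ B | cat z = c} : Finset M) :=
            mem_filter.mpr ⟨hy, hxy ▸ hc⟩
          refine (card_insert_le _ _).trans ?_
          rw [card_erase_add_one hyc]
          exact hB'.1 c
        · exact (card_le_card (erase_subset _ _)).trans (hB'.1 c)
      · have heq : S \ insert x (B.erase y) = insert y ((S \ B).erase x) := by
          ext z
          simp only [mem_sdiff, mem_insert, mem_erase]
          by_cases hzy : z = y
          · subst hzy
            simp [hyS, hne.symm]
          · tauto
        rw [heq, filter_insert, filter_erase]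
        split_ifs with hc
        · have hxc : x ∈ ({z ∈ S \ B | cat z = c} : Finset M) :=
            mem_filter.mpr ⟨hx, hxy.trans hc⟩
          refine (card_insert_le _ _).trans ?_
          rw [card_erase_add_one hxc]
          exact hB'.2.1 c
        · exact (card_le_card (erase_subset _ _)).trans (hB'.2.1 c)
    have := hmax _ hmem
    simp only [hval] at this
    linarith
  have hlarge : ((1 : ℕ) : ℝ) * ∑ x ∈ S \ B, w i₀ x ≤ n * ∑ x ∈ B, w i₀ x := by
    refine sum_le_sum_of_categories cat _ fun c => ?_
    rcases lt_or_ge #{y ∈ B | cat y = c} (k c) with hlt | hge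
    · have : ∑ x ∈ S \ B with cat x = c, w i₀ x = 0 := by
        refine sum_eq_zero fun x hx => ?_
        obtain ⟨hxS, rfl⟩ := mem_filter.mp hx
        exact hfree x hxS hlt
      rw [this, mul_zero]
      exact mul_nonneg n.cast_nonneg (sum_nonneg fun x _ => hw _ x)
    · refine mul_sum_le_mul_sum_of_dominated _ (fun x _ => hw _ x) (fun y hy x hx => ?_) ?_
      · rw [mem_filter] at hx hy
        exact hswap x hx.1 y hy.1 (hx.2.trans hy.2.symm)
      · rw [one_mul]
        exact (hB'.2.1 c).trans (Nat.mul_le_mul_left _ hge)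
  have h1 := sum_sdiff (f := w i₀) hBS
  have h2 := hsum i₀ hi₀
  have h3 := hlow i₀ hi₀
  have h4 : 0 ≤ ∑ x ∈ B, w i₀ x := sum_nonneg fun x _ => hw _ x
  push_cast at hlarge
  have h5 : ((n : ℝ) + 1) * μ i₀ ≤ (n + 1) * ∑ x ∈ B, w i₀ x := by linarith
  have h6 := le_of_mul_le_mul_left h5 (by positivity)
  linarith

/-- Bag filling when all items are small. -/
lemma hasHalfPacking_of_small (hw : ∀ i x, 0 ≤ w i x)
    (hanti : ∀ i x y, cat x = cat y → x ≤ y → w i y ≤ w i x) (n : ℕ) :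
    ∀ (T : Finset ι) (S : Finset M), #T = n → (∀ h, #{x ∈ S | cat x = h} ≤ n * k h) →
      (∀ i ∈ T, n * μ i ≤ ∑ x ∈ S, w i x) → (∀ i ∈ T, ∀ x ∈ S, w i x ≤ μ i / 2) →
      HasHalfPacking cat k w μ T S := by
  classical
  induction n with
  | zero =>
    intro T S hT _ _ _
    rw [card_eq_zero] at hT
    subst hT
    exact ⟨fun _ => ∅, by simp, by simp⟩
  | succ n ih =>
    intro T S hT hS hsum hsmall
    have hne : T.Nonempty := card_pos.mp (by omega)
    push_cast at hsum
    obtain ⟨B, hBS, hB, hcard, hrest, i, hi, hval⟩ := exists_bag hw hanti hne hS hsum hsmall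
    refine HasHalfPacking.of_erase hBS hB hval (ih _ _ ?_ hcard ?_ ?_)
    · rw [card_erase_of_mem hi, hT, Nat.add_sub_cancel]
    · exact fun j hj => hrest j (mem_of_mem_erase hj)
    · exact fun j hj x hx => hsmall j (mem_of_mem_erase hj) x (sdiff_subset hx)

/-- In an ordered instance, half of the maximin shares can be packed. -/
lemma hasHalfPacking_of_ordered {q : Type*} [Fintype q] (hw : ∀ i x, 0 ≤ w i x)
    (hanti : ∀ i x y, cat x = cat y → x ≤ y → w i y ≤ w i x) (hk : ∀ x, 1 ≤ k (cat x))
    (P : ι → q → Finset M) (hP : ∀ i a, FeasibleBundle cat k (P i a))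
    (hPd : ∀ i a b, a ≠ b → Disjoint (P i a) (P i b))
    (hPμ : ∀ i a, μ i ≤ ∑ x ∈ P i a, w i x) (n : ℕ) :
    ∀ (T : Finset ι) (S : Finset M), #T = n → (∀ i ∈ T, n ≤ #{a | P i a ⊆ S}) →
      HasHalfPacking cat k w μ T S := by
  classical
  induction n with
  | zero =>
    intro T S hT _
    rw [card_eq_zero] at hT
    subst hT
    exact ⟨fun _ => ∅, by simp, by simp⟩
  | succ n ih =>
    intro T S hT hTS
    by_cases hbig : ∃ i ∈ T, ∃ x ∈ S, μ i / 2 ≤ w i x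
    · obtain ⟨i, hi, x, hx, hval⟩ := hbig
      refine HasHalfPacking.of_erase (B := {x}) (i := i) (by simpa using hx) (fun c => ?_)
        (by simpa using hval) (ih _ _ ?_ fun j hj => ?_)
      · rw [filter_singleton]
        split_ifs with hc
        · subst hc
          simpa using hk x
        · simp
      · rw [card_erase_of_mem hi, hT, Nat.add_sub_cancel]
      · have h1 := hTS j (mem_of_mem_erase hj)
        have h2 : #{a ∈ ({a | P j a ⊆ S} : Finset q) | x ∈ P j a} ≤ 1 := by
          refine card_le_one.mpr fun a ha b hb => ?_
          by_contra hab
          exact disjoint_left.mp (hPd j a b hab) (mem_filter.mp ha).2 (mem_filter.mp hb).2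
        have h3 := card_filter_add_card_filter_not (s := ({a | P j a ⊆ S} : Finset q))
          (fun a => x ∈ P j a)
        have h4 : #{a ∈ ({a | P j a ⊆ S} : Finset q) | x ∉ P j a} ≤ #{a | P j a ⊆ S \ {x}} := by
          refine card_le_card fun a ha => ?_
          simp only [mem_filter, mem_univ, true_and] at ha ⊢
          exact subset_sdiff.mpr ⟨ha.1, disjoint_singleton_right.mpr ha.2⟩
        omega
    · push Not at hbig
      obtain ⟨U, hUS, hU, hle⟩ :=
        exists_initial_subset_of_categories cat S fun h => (n + 1) * k h
      refine HasHalfPacking.mono (hasHalfPacking_of_small hw hanti (n + 1) T U hT (fun h => ?_)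
        (fun i hi => ?_) fun i hi x hx => (hbig i hi x (hUS hx)).le) hUS
      · rw [hU]
        exact min_le_left _ _
      · obtain ⟨Q, hQ, hQn⟩ := exists_subset_card_eq (hTS i hi)
        set V := Q.biUnion (P i) with hV
        have hVS : V ⊆ S := biUnion_subset.mpr fun a ha => (mem_filter.mp (hQ ha)).2
        have hVsum : ((n + 1 : ℕ) : ℝ) * μ i ≤ ∑ x ∈ V, w i x := by
          rw [hV, sum_biUnion fun a _ b _ hab => hPd i a b hab, ← hQn, ← nsmul_eq_mul]
          exact card_nsmul_le_sum _ _ _ fun a _ => hPμ i a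
        have hVcard : ∀ c, #{x ∈ V | cat x = c} ≤ #{x ∈ U | cat x = c} := by
          intro c
          rw [hU]
          refine le_min ?_ (card_le_card (filter_subset_filter _ hVS))
          rw [hV, filter_biUnion, ← hQn]
          exact card_biUnion_le_card_mul _ _ _ fun a _ => hP i a c
        have hdom : ((1 : ℕ) : ℝ) * ∑ x ∈ V \ U, w i x ≤ (1 : ℕ) * ∑ x ∈ U \ V, w i x := by
          refine sum_le_sum_of_categories cat _ fun c => ?_
          refine mul_sum_le_mul_sum_of_dominated _ (fun x _ => hw i x) (fun x hx y hy => ?_) ?_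
          · rw [mem_filter, mem_sdiff] at hx hy
            have hxy := hx.2.trans hy.2.symm
            exact hanti i x y hxy
              (hle x hx.1.1 y (mem_sdiff.mpr ⟨hVS hy.1.1, hy.1.2⟩) hxy)
          · have hsd : ∀ X Y : Finset M, ({x ∈ X \ Y | cat x = c} : Finset M) =
                {x ∈ X | cat x = c} \ {x ∈ Y | cat x = c} := by
              intro X Y
              ext x
              simp only [mem_filter, mem_sdiff]
              tauto
            rw [one_mul, one_mul, hsd, hsd]
            exact card_sdiff_le_card_sdiff_iff.mpr (hVcard c)
        have h1 := sum_sdiff_sub_sum_sdiff (s₁ := V) (s₂ := U) (f := w i)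
        push_cast at hdom hVsum ⊢
        linarith

end Ordered

/-- Every instance of fair allocation under cardinality constraints
(with `|C_h| ≤ n · k h` for all categories) admits a feasible 1/2-approximate MMS
allocation. -/
theorem stmt_14 {m ℓ n : ℕ} (hn : 1 ≤ n)
    (cat : Fin m → Fin ℓ) (k : Fin ℓ → ℕ)
    (hcard : ∀ h, (univ.filter (fun x => cat x = h)).card ≤ n * k h)
    (v : Fin n → Fin m → ℝ) (hv : ∀ i j, 0 ≤ v i j) :
    ∃ A : Fin n → Finset (Fin m), FeasibleAlloc cat k A ∧
      ∀ i, mms n cat k (v i) / 2 ≤ ∑ j ∈ A i, v i j := by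
  have hk : ∀ x, 1 ≤ k (cat x) := by
    intro x
    have h1 : 0 < n * k (cat x) :=
      (card_pos.mpr ⟨x, by simp⟩).trans_le (hcard (cat x))
    exact Nat.pos_of_mul_pos_left h1
  choose σ hσ hanti using fun i => exists_perm_antitone_on_categories cat (v i)
  choose P hP hPμ using fun i => exists_feasibleAlloc_mms_le hcard (v i)
  have hσ' : ∀ i x, cat ((σ i).symm x) = cat x := fun i x => by
    rw [← hσ i, Equiv.apply_symm_apply]
  obtain ⟨B, hB, hd⟩ := hasHalfPacking_of_ordered (cat := cat) (k := k)
    (w := fun i x => v i (σ i x)) (μ := fun i => mms n cat k (v i)) (fun i x => hv i _) hanti hk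
    (fun i a => (P i a).map (σ i).symm.toEmbedding)
    (fun i a => ((hP i).2 a).map _ (hσ' i))
    (fun i a b hab => (disjoint_map _).mpr <| disjoint_left.mpr fun x ha hb =>
      hab (((hP i).1 x).unique ha hb))
    (fun i a => by simpa [sum_map] using hPμ i a) n univ univ (by simp) (by simp)
  simp only [mem_univ, true_imp_iff] at hB hd
  obtain ⟨A, hA, hBA⟩ := exists_feasibleAlloc_of_disjoint hcard B (fun i => (hB i).2.1) hd
  choose o ho using fun x => (hA.1 x).exists
  obtain ⟨e, he, hle⟩ := exists_embedding_le_of_owner cat v σ hσ hanti o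
  obtain ⟨A', hA', hAA'⟩ := exists_feasibleAlloc_of_disjoint hcard (fun i => (A i).map e)
    (fun i => (hA.2 i).map e he) (fun i j hij => (disjoint_map e).mpr <|
      disjoint_left.mpr fun x hi hj => hij ((hA.1 x).unique hi hj))
  refine ⟨A', hA', fun i => ?_⟩
  calc mms n cat k (v i) / 2 ≤ ∑ x ∈ B i, v i (σ i x) := (hB i).2.2
    _ ≤ ∑ x ∈ A i, v i (σ i x) :=
      sum_le_sum_of_subset_of_nonneg (hBA i) fun x _ _ => hv i _
    _ ≤ ∑ x ∈ A i, v i (e x) := sum_le_sum fun x hx => by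
      have hox : o x = i := (hA.1 x).unique (ho x) hx
      simpa only [hox] using hle x
    _ = ∑ x ∈ (A i).map e, v i x := (sum_map _ _ _).symm
    _ ≤ ∑ x ∈ A' i, v i x := sum_le_sum_of_subset_of_nonneg (hAA' i) fun x _ _ => hv i x
end

section
/- Let M be a finite set partitioned into categories C_1, …, C_ℓ, let n ≥ 2, and let v : M → ℝ≥0 be an additive valuation with v(M) ≥ n. Let L ⊆ M consist of, for each category C_h, a set of ⌊|C_h|/n⌋ items of C_h of minimal value. Then v(M \ L) ≥ (n−1)·v(M)/n ≥ n − 1; in particular, removing any bundle B with v(B) ≤ v(L) from M leaves a set of value at least n − 1. -/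
open Finset

/-- If the elements of `s ⊆ t` have minimal value in `t` and `t` has at least `n` times as many
elements as `s`, then the value of `t` is at least `n` times that of `s`. -/
theorem natCast_mul_sum_le_sum_of_minimal {ι : Type*} [DecidableEq ι] {s t : Finset ι} {v : ι → ℝ}
    {n : ℕ} (hv : ∀ j, 0 ≤ v j) (hst : s ⊆ t) (hn : 1 ≤ n) (hcard : #s * n ≤ #t)
    (hmin : ∀ x ∈ t \ s, ∀ y ∈ s, v y ≤ v x) :
    (n : ℝ) * ∑ j ∈ s, v j ≤ ∑ j ∈ t, v j := by
  rcases s.eq_empty_or_nonempty with rfl | hs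
  · simpa using sum_nonneg fun j _ => hv j
  obtain ⟨y, hy, hmax⟩ := s.exists_max_image v hs
  have upper : ∑ j ∈ s, v j ≤ #s * v y := by
    simpa using sum_le_card_nsmul s v (v y) hmax
  have lower : #(t \ s) * v y ≤ ∑ j ∈ t \ s, v j := by
    simpa using card_nsmul_le_sum (t \ s) v (v y) fun x hx => hmin x hx y hy
  have hsplit := sum_sdiff (f := v) hst
  have hcard' : (#s : ℝ) * n ≤ #(t \ s) + #s := by
    rw [← card_sdiff_add_card_eq_card hst] at hcard
    exact_mod_cast hcard
  have hn' : (0 : ℝ) ≤ n - 1 := sub_nonneg.2 (by exact_mod_cast hn)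
  nlinarith [mul_le_mul_of_nonneg_left upper hn', mul_le_mul_of_nonneg_right hcard' (hv y)]

/-- If `v(M) ≥ n` and `L` consists of, for each category, a set of
`⌊|C_h|/n⌋` items of minimal value, then `v(M \ L) ≥ (n-1)·v(M)/n ≥ n - 1`; in
particular removing any bundle `B` with `v(B) ≤ v(L)` leaves value at least `n-1`. -/
theorem stmt_17 {m ℓ n : ℕ} (hn : 2 ≤ n)
    (cat : Fin m → Fin ℓ)
    (v : Fin m → ℝ) (hv : ∀ j, 0 ≤ v j)
    (hval : (n : ℝ) ≤ ∑ j, v j)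
    (L : Fin ℓ → Finset (Fin m))
    (hL : ∀ h, L h ⊆ univ.filter (fun x => cat x = h))
    (hLcard : ∀ h, (L h).card = (univ.filter (fun x => cat x = h)).card / n)
    (hLmin : ∀ h, ∀ x ∈ (univ.filter (fun x => cat x = h)) \ L h,
      ∀ y ∈ L h, v y ≤ v x) :
    ((n : ℝ) - 1) * (∑ j, v j) / n ≤ ∑ j ∈ univ \ univ.biUnion L, v j ∧
    (n : ℝ) - 1 ≤ ∑ j ∈ univ \ univ.biUnion L, v j ∧
    ∀ B : Finset (Fin m), ∑ j ∈ B, v j ≤ ∑ j ∈ univ.biUnion L, v j →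
      (n : ℝ) - 1 ≤ ∑ j ∈ univ \ B, v j := by
  have hn0 : (0 : ℝ) < n := by positivity
  have hdisj : Set.PairwiseDisjoint (univ : Finset (Fin ℓ)) L := by
    intro a _ b _ hab
    refine disjoint_left.2 fun x hxa hxb => hab ?_
    rw [← (mem_filter.1 (hL a hxa)).2, ← (mem_filter.1 (hL b hxb)).2]
  have key : (n : ℝ) * ∑ j ∈ univ.biUnion L, v j ≤ ∑ j, v j := by
    rw [sum_biUnion hdisj, mul_sum, ← sum_fiberwise univ cat v]
    refine sum_le_sum fun h _ => ?_
    refine natCast_mul_sum_le_sum_of_minimal hv (hL h) (one_le_two.trans hn) ?_ (hLmin h)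
    rw [hLcard h]
    exact Nat.div_mul_le_self _ _
  have hsplit (B : Finset (Fin m)) : ∑ j ∈ univ \ B, v j + ∑ j ∈ B, v j = ∑ j, v j :=
    sum_sdiff (subset_univ B)
  have first : ((n : ℝ) - 1) * (∑ j, v j) / n ≤ ∑ j ∈ univ \ univ.biUnion L, v j := by
    rw [div_le_iff₀ hn0]
    linear_combination key - n * hsplit (univ.biUnion L)
  have second : (n : ℝ) - 1 ≤ ∑ j ∈ univ \ univ.biUnion L, v j := by
    refine le_trans ?_ first
    rw [le_div_iff₀ hn0]
    exact mul_le_mul_of_nonneg_left hval (sub_nonneg.2 (by exact_mod_cast (by lia : 1 ≤ n)))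
  refine ⟨first, second, fun B hB => ?_⟩
  linarith [hsplit B, hsplit (univ.biUnion L)]
end
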